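/- arXiv:math/0701485 — 2 statements merged into one kernel-verified Lean document; each statement's English description precedes it below -/
import Mathlib

section
/- Let (F_ε)_{ε∈(0,1]} be a c-bounded net of maps from Ω₁ into Ω₂. Then for every compact set X₀ ⊆ Ω₁, the set C_F ∩ (X₀ × Ω₂) is a compact subset of Ω₁ × Ω₂. -/
open Set Filter Topology

/-- `y` is a cluster point of the net `(z ε)_{ε ∈ (0,1]}` as `ε → 0`: for every
neighborhood `U` of `y` and every `ε₀ ∈ (0,1]` there is `ε < ε₀` (with `ε > 0`)
such that `z ε ∈ U`. -/
def IsClusterPtNet {F : Type*} [TopologicalSpace F] (z : ℝ → F) (y : F) : Prop :=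
  ∀ U ∈ nhds y, ∀ ε₀ ∈ Set.Ioc (0:ℝ) 1, ∃ ε, 0 < ε ∧ ε < ε₀ ∧ z ε ∈ U

/-- The net of maps `(Fnet ε)_{ε ∈ (0,1]}` is c-bounded from `Ω₁` into `Ω₂`:
for every compact `K ⊆ Ω₁` there are a compact `K' ⊆ Ω₂` and `ε₀ > 0` such that
`Fnet ε '' K ⊆ K'` for all `ε ∈ (0,1]` with `ε ≤ ε₀`. -/
def CBounded {E F : Type*} [TopologicalSpace E] [TopologicalSpace F]
    (Fnet : ℝ → E → F) (Ω₁ : Set E) (Ω₂ : Set F) : Prop :=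
  ∀ K ⊆ Ω₁, IsCompact K → ∃ K' ⊆ Ω₂, IsCompact K' ∧
    ∃ ε₀ > (0:ℝ), ∀ ε ∈ Set.Ioc (0:ℝ) 1, ε ≤ ε₀ → Fnet ε '' K ⊆ K'

/-- The generalized graph `C_F` of the net `(Fnet ε)_{ε∈(0,1]}` relative to `Ω₁, Ω₂`:
all pairs `(x,y) ∈ Ω₁ × Ω₂` such that there exist a net `(x_ε)` in `Ω₁` tending to `x`
as `ε → 0` and a map `τ : (0,1] → (0,1]` with `τ ε ≤ ε`, such that `y` is a cluster
point of `(Fnet (τ ε) (x_ε))_{ε}`. -/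
def GenGraph {E F : Type*} [TopologicalSpace E] [TopologicalSpace F]
    (Fnet : ℝ → E → F) (Ω₁ : Set E) (Ω₂ : Set F) : Set (E × F) :=
  {p | p.1 ∈ Ω₁ ∧ p.2 ∈ Ω₂ ∧ ∃ (x : ℝ → E) (τ : ℝ → ℝ),
    (∀ ε ∈ Set.Ioc (0:ℝ) 1, x ε ∈ Ω₁) ∧
    (∀ ε ∈ Set.Ioc (0:ℝ) 1, τ ε ∈ Set.Ioc (0:ℝ) 1 ∧ τ ε ≤ ε) ∧
    Filter.Tendsto x (nhdsWithin 0 (Set.Ioc (0:ℝ) 1)) (nhds p.1) ∧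
    IsClusterPtNet (fun ε => Fnet (τ ε) (x ε)) p.2}

/-- The net `(Fnet ε)` is equi-continuous at `x₀`: for every `γ > 0` there is `δ > 0`
with `‖Fnet ε x - Fnet ε x₀‖ < γ` for all `x ∈ Ω₁` with `‖x - x₀‖ < δ` and all
`ε ∈ (0,1]`. -/
def EquiContAt {E F : Type*} [NormedAddCommGroup E] [NormedAddCommGroup F]
    (Fnet : ℝ → E → F) (Ω₁ : Set E) (x₀ : E) : Prop :=
  ∀ γ > (0:ℝ), ∃ δ > (0:ℝ), ∀ x ∈ Ω₁, ‖x - x₀‖ < δ →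
    ∀ ε ∈ Set.Ioc (0:ℝ) 1, ‖Fnet ε x - Fnet ε x₀‖ < γ

/-- The points of the graphs of the maps `Fnet ε` over `Ω₁`, for all `ε ∈ (0,1]` with `ε < η`. -/
def graphsBelow {E F : Type*} (Fnet : ℝ → E → F) (Ω₁ : Set E) (η : ℝ) : Set (E × F) :=
  {p | ∃ ε ∈ Set.Ioc (0:ℝ) 1, ε < η ∧ p.1 ∈ Ω₁ ∧ Fnet ε p.1 = p.2}

/-- The generalized graph is the set of points of `Ω₁ × Ω₂` that are adherent to the graphs of
`Fnet ε` for arbitrarily small `ε`. -/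
theorem genGraph_eq_inter_closure {E F : Type*} [PseudoMetricSpace E] [PseudoMetricSpace F]
    (Fnet : ℝ → E → F) (Ω₁ : Set E) (Ω₂ : Set F) :
    GenGraph Fnet Ω₁ Ω₂ = Ω₁ ×ˢ Ω₂ ∩ ⋂ η > (0:ℝ), closure (graphsBelow Fnet Ω₁ η) := by
  ext ⟨a, b⟩
  simp only [GenGraph, mem_ofPred_eq, mem_inter_iff, mem_prod, mem_iInter]
  constructor
  · rintro ⟨ha, hb, x, τ, hx, hτ, hlim, hcl⟩
    refine ⟨⟨ha, hb⟩, fun η hη => Metric.mem_closure_iff.2 fun r hr => ?_⟩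
    obtain ⟨δ, hδ, hδx⟩ := Metric.mem_nhdsWithin_iff.1 (hlim (Metric.ball_mem_nhds a hr))
    obtain ⟨ε, hε, hεlt, hεb⟩ := hcl _ (Metric.ball_mem_nhds b hr) (min 1 (min δ η))
      ⟨by positivity, min_le_left _ _⟩
    obtain ⟨hε1, hεδ, hεη⟩ : ε < 1 ∧ ε < δ ∧ ε < η := by simpa using hεlt
    have hεI : ε ∈ Set.Ioc (0:ℝ) 1 := ⟨hε, hε1.le⟩
    have hxa : x ε ∈ Metric.ball a r :=
      hδx ⟨by simpa [Real.dist_eq, abs_of_pos hε] using hεδ, hεI⟩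
    refine ⟨(x ε, Fnet (τ ε) (x ε)),
      ⟨τ ε, (hτ ε hεI).1, (hτ ε hεI).2.trans_lt hεη, hx ε hεI, rfl⟩, ?_⟩
    rw [dist_comm, Prod.dist_eq]
    exact max_lt hxa hεb
  · rintro ⟨⟨ha, hb⟩, hclos⟩
    have hex : ∀ ε : ℝ, ∃ (x : E) (t : ℝ), 0 < ε → x ∈ Ω₁ ∧ t ∈ Set.Ioc (0:ℝ) 1 ∧ t ≤ ε ∧
        dist x a < ε ∧ dist (Fnet t x) b < ε := by
      intro ε
      by_cases hε : 0 < ε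
      · obtain ⟨q, ⟨t, ht, htε, hx, hq⟩, hd⟩ :=
          Metric.mem_closure_iff.1 (hclos ε hε) ε hε
        rw [dist_comm, Prod.dist_eq, max_lt_iff] at hd
        exact ⟨q.1, t, fun _ => ⟨hx, ht, htε.le, hd.1, hq ▸ hd.2⟩⟩
      · exact ⟨a, 0, fun h => absurd h hε⟩
    choose x τ hxτ using hex
    refine ⟨ha, hb, x, τ, fun ε hε => (hxτ ε hε.1).1,
      fun ε hε => ⟨(hxτ ε hε.1).2.1, (hxτ ε hε.1).2.2.1⟩, ?_, ?_⟩
    · refine Metric.tendsto_nhdsWithin_nhds.2 fun r hr => ⟨r, hr, fun {ε} hε hd => ?_⟩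
      rw [Real.dist_eq, sub_zero, abs_of_pos hε.1] at hd
      exact (hxτ ε hε.1).2.2.2.1.trans hd
    · intro U hU ε₀ hε₀
      obtain ⟨r, hr, hrU⟩ := Metric.mem_nhds_iff.1 hU
      obtain ⟨ε, hε, hεlt⟩ := exists_between (lt_min hε₀.1 hr)
      obtain ⟨hlt, hltr⟩ := lt_min_iff.1 hεlt
      exact ⟨ε, hε, hlt, hrU ((hxτ ε hε).2.2.2.2.trans hltr)⟩

/-- Over a compact subset of `Ω₁`, the generalized graph of a c-bounded net has its values in a
compact subset of `Ω₂`. -/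
theorem CBounded.exists_isCompact_genGraph_subset {E F : Type*} [PseudoMetricSpace E]
    [LocallyCompactSpace E] [MetricSpace F] {Fnet : ℝ → E → F} {Ω₁ : Set E} {Ω₂ : Set F}
    (hcb : CBounded Fnet Ω₁ Ω₂) (hΩ₁ : IsOpen Ω₁) {X₀ : Set E} (hX₀ : IsCompact X₀)
    (hX₀Ω : X₀ ⊆ Ω₁) :
    ∃ K' ⊆ Ω₂, IsCompact K' ∧ ∀ p ∈ GenGraph Fnet Ω₁ Ω₂, p.1 ∈ X₀ → p.2 ∈ K' := by
  obtain ⟨K, hK, hXK, hKΩ⟩ := exists_compact_between hX₀ hΩ₁ hX₀Ω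
  obtain ⟨K', hK'Ω, hK', ε₀, hε₀, hmaps⟩ := hcb K hKΩ hK
  refine ⟨K', hK'Ω, hK', fun p hp hpX => ?_⟩
  rw [genGraph_eq_inter_closure] at hp
  have hpc := mem_iInter₂.1 hp.2 ε₀ hε₀
  rw [← hK'.isClosed.closure_eq]
  refine mem_closure_iff_nhds.2 fun V hV => ?_
  obtain ⟨q, ⟨hqK, hqV⟩, ε, hε, hεlt, -, hq⟩ := mem_closure_iff_nhds.1 hpc _
    (prod_mem_nhds (mem_interior_iff_mem_nhds.1 (hXK hpX)) hV)
  exact ⟨q.2, hqV, hmaps ε hε hεlt.le ⟨q.1, hqK, hq⟩⟩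

/-- For every compact `X₀ ⊆ Ω₁`, the set `C_F ∩ (X₀ × Ω₂)` is a compact subset of
`Ω₁ × Ω₂` (here we intersect with `X₀ ×ˢ univ`; since `C_F ⊆ Ω₁ ×ˢ Ω₂`, this is
exactly `C_F ∩ (X₀ ×ˢ Ω₂)`). -/
theorem genGraph_inter_compact {n m : ℕ}
    (Ω₁ : Set (EuclideanSpace ℝ (Fin n))) (Ω₂ : Set (EuclideanSpace ℝ (Fin m)))
    (hΩ₁ : IsOpen Ω₁) (hΩ₂ : IsOpen Ω₂)
    (Fnet : ℝ → EuclideanSpace ℝ (Fin n) → EuclideanSpace ℝ (Fin m))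
    (hcont : ∀ ε ∈ Set.Ioc (0:ℝ) 1, ContinuousOn (Fnet ε) Ω₁)
    (hcb : CBounded Fnet Ω₁ Ω₂)
    (X₀ : Set (EuclideanSpace ℝ (Fin n))) (hX₀ : IsCompact X₀) (hX₀Ω : X₀ ⊆ Ω₁) :
    IsCompact (GenGraph Fnet Ω₁ Ω₂ ∩ X₀ ×ˢ (Set.univ : Set (EuclideanSpace ℝ (Fin m)))) := by
  obtain ⟨K', hK'Ω, hK', hgraph⟩ := hcb.exists_isCompact_genGraph_subset hΩ₁ hX₀ hX₀Ω
  have heq : GenGraph Fnet Ω₁ Ω₂ ∩ X₀ ×ˢ univ =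
      X₀ ×ˢ K' ∩ ⋂ η > (0:ℝ), closure (graphsBelow Fnet Ω₁ η) := by
    ext p
    constructor
    · rintro ⟨hp, hpX, -⟩
      refine ⟨⟨hpX, hgraph p hp hpX⟩, ?_⟩
      rw [genGraph_eq_inter_closure] at hp
      exact hp.2
    · rintro ⟨⟨hpX, hpK⟩, hp⟩
      rw [genGraph_eq_inter_closure]
      exact ⟨⟨⟨hX₀Ω hpX, hK'Ω hpK⟩, hp⟩, hpX, mem_univ _⟩
  rw [heq]
  exact (hX₀.prod hK').inter_right (isClosed_biInter fun _ _ => isClosed_closure)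
end

section
/- Let g : ℝ → ℝ be continuous and bounded with lim_{z→−∞} g(z) = 0 and lim_{z→+∞} g(z) = 1, and define F_ε(x) := g(x/ε) for ε ∈ (0,1]. Then (F_ε)_{ε∈(0,1]} is a c-bounded net of maps from ℝ into ℝ and its generalized graph is C_F = ((−∞,0) × {0}) ∪ ({0} × closure(g(ℝ))) ∪ ((0,∞) × {1}). -/
open Set Filter Topology

theorem isClusterPtNet_iff_mapClusterPt {F : Type*} [TopologicalSpace F] {z : ℝ → F} {y : F} :
    IsClusterPtNet z y ↔ MapClusterPt y (𝓝[>] 0) z := by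
  simp only [mapClusterPt_iff_frequently, (nhdsGT_basis (0 : ℝ)).frequently_iff]
  constructor
  · intro h U hU r hr
    obtain ⟨ε, h0, hε, hz⟩ := h U hU (min r 1) ⟨lt_min hr one_pos, min_le_right _ _⟩
    exact ⟨ε, ⟨h0, hε.trans_le (min_le_left _ _)⟩, hz⟩
  · intro h U hU r hr
    obtain ⟨ε, hε, hz⟩ := h U hU r hr.1
    exact ⟨ε, hε.1, hε.2, hz⟩

theorem IsClusterPtNet.eq_of_tendsto {F : Type*} [TopologicalSpace F] [T2Space F] {z : ℝ → F}
    {y a : F} (hy : IsClusterPtNet z y) (ha : Tendsto z (𝓝[>] 0) (𝓝 a)) : y = a := by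
  have h : ClusterPt y (𝓝 a) := (isClusterPtNet_iff_mapClusterPt.1 hy).clusterPt.mono ha
  exact eq_of_nhds_neBot h

theorem isClusterPtNet_of_tendsto {F : Type*} [TopologicalSpace F] {z : ℝ → F} {y : F}
    (h : Tendsto z (𝓝[>] 0) (𝓝 y)) : IsClusterPtNet z y :=
  isClusterPtNet_iff_mapClusterPt.2 h.mapClusterPt

theorem IsClusterPtNet.mem_closure_range {F : Type*} [TopologicalSpace F] {z : ℝ → F} {y : F}
    (hy : IsClusterPtNet z y) : y ∈ closure (range z) := by
  refine mem_closure_iff_nhds.2 fun U hU => ?_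
  obtain ⟨ε, -, -, hz⟩ := hy U hU 1 ⟨one_pos, le_rfl⟩
  exact ⟨z ε, hz, mem_range_self ε⟩

theorem tendsto_inv_atTop_of_le_self {τ : ℝ → ℝ}
    (hτ : ∀ ε ∈ Ioc (0 : ℝ) 1, τ ε ∈ Ioc (0 : ℝ) 1 ∧ τ ε ≤ ε) :
    Tendsto (fun ε => (τ ε)⁻¹) (𝓝[>] 0) atTop := by
  have hmem : ∀ᶠ ε in 𝓝[>] (0 : ℝ), ε ∈ Ioc (0 : ℝ) 1 := Ioc_mem_nhdsGT one_pos
  refine tendsto_atTop_mono' _ ?_ tendsto_inv_nhdsGT_zero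
  filter_upwards [hmem] with ε hε
  exact inv_anti₀ (hτ ε hε).1.1 (hτ ε hε).2

/-- Approximants of a point of `closure (range g)` are values of the rescaled net along points
tending to `0`. -/
theorem zero_mem_genGraph_of_mem_closure {g : ℝ → ℝ} {y : ℝ} (hy : y ∈ closure (range g)) :
    ((0 : ℝ), y) ∈ GenGraph (fun ε x => g (x / ε)) (univ : Set ℝ) (univ : Set ℝ) := by
  have hex : ∀ ε : ℝ, ∃ w, 0 < ε → dist (g w) y < ε := fun ε => by
    by_cases hε : 0 < ε
    · obtain ⟨_, ⟨w, rfl⟩, hw⟩ := Metric.mem_closure_iff.1 hy ε hε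
      exact ⟨w, fun _ => by rwa [dist_comm]⟩
    · exact ⟨0, fun h => absurd h hε⟩
  choose w hw using hex
  have hpos : ∀ ε, 0 < 1 + |w ε| := fun ε => by positivity
  have hle : ∀ ε, 0 < ε → ε / (1 + |w ε|) ≤ ε := fun ε hε =>
    div_le_self hε.le (by linarith [abs_nonneg (w ε)])
  have hid : Tendsto (fun ε : ℝ => ε) (𝓝[>] 0) (𝓝 0) :=
    tendsto_nhdsWithin_of_tendsto_nhds tendsto_id
  refine ⟨mem_univ _, mem_univ _, fun ε => ε / (1 + |w ε|) * w ε, fun ε => ε / (1 + |w ε|),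
    fun _ _ => mem_univ _,
    fun ε hε => ⟨⟨div_pos hε.1 (hpos ε), (hle ε hε.1).trans hε.2⟩, hle ε hε.1⟩, ?_, ?_⟩
  · rw [nhdsWithin_Ioc_eq_nhdsGT one_pos]
    refine squeeze_zero_norm' ?_ hid
    filter_upwards [self_mem_nhdsWithin] with ε hε
    have hε : 0 < ε := hε
    rw [Real.norm_eq_abs, abs_mul, abs_of_pos (div_pos hε (hpos ε)), div_mul_eq_mul_div,
      div_le_iff₀ (hpos ε)]
    nlinarith
  · refine isClusterPtNet_of_tendsto (tendsto_iff_dist_tendsto_zero.2 ?_)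
    refine squeeze_zero' (Eventually.of_forall fun _ => dist_nonneg) ?_ hid
    filter_upwards [self_mem_nhdsWithin] with ε hε
    have hε : 0 < ε := hε
    rw [mul_div_cancel_left₀ _ (div_pos hε (hpos ε)).ne']
    exact (hw ε hε).le

/-- For a continuous bounded `g : ℝ → ℝ` with `g(z) → 0` as `z → −∞` and `g(z) → 1`
as `z → +∞`, the net `F_ε(x) := g(x/ε)` is c-bounded from `ℝ` into `ℝ` and its
generalized graph is
`C_F = ((−∞,0) × {0}) ∪ ({0} × closure(g(ℝ))) ∪ ((0,∞) × {1})`. -/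
theorem genGraph_scaled_heaviside (g : ℝ → ℝ) (hg : Continuous g)
    (hbd : ∃ M, ∀ x, |g x| ≤ M)
    (h0 : Filter.Tendsto g Filter.atBot (nhds 0))
    (h1 : Filter.Tendsto g Filter.atTop (nhds 1)) :
    CBounded (fun ε x => g (x / ε)) (Set.univ : Set ℝ) (Set.univ : Set ℝ) ∧
    GenGraph (fun ε x => g (x / ε)) (Set.univ : Set ℝ) (Set.univ : Set ℝ) =
      (Set.Iio (0:ℝ) ×ˢ ({0} : Set ℝ)) ∪
      (({0} : Set ℝ) ×ˢ closure (Set.range g)) ∪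
      (Set.Ioi (0:ℝ) ×ˢ ({1} : Set ℝ)) := by
  have lim_neg : ∀ {x τ : ℝ → ℝ} {a : ℝ}, a < 0 → Tendsto x (𝓝[>] 0) (𝓝 a) →
      Tendsto (fun ε => (τ ε)⁻¹) (𝓝[>] 0) atTop →
      Tendsto (fun ε => g (x ε / τ ε)) (𝓝[>] 0) (𝓝 0) := fun ha hx hτ =>
    h0.comp (hx.neg_mul_atTop ha hτ)
  have lim_pos : ∀ {x τ : ℝ → ℝ} {a : ℝ}, 0 < a → Tendsto x (𝓝[>] 0) (𝓝 a) →
      Tendsto (fun ε => (τ ε)⁻¹) (𝓝[>] 0) atTop →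
      Tendsto (fun ε => g (x ε / τ ε)) (𝓝[>] 0) (𝓝 1) := fun ha hx hτ =>
    h1.comp (hx.pos_mul_atTop ha hτ)
  refine ⟨?_, ?_⟩
  · intro K _ _
    obtain ⟨M, hM⟩ := hbd
    refine ⟨Icc (-M) M, subset_univ _, isCompact_Icc, 1, one_pos, ?_⟩
    rintro ε _ _ _ ⟨x, _, rfl⟩
    exact abs_le.1 (hM _)
  ext ⟨a, y⟩
  simp only [mem_union, mem_prod, mem_Iio, mem_Ioi, mem_singleton_iff]
  constructor
  · rintro ⟨-, -, x, τ, -, hτ, hx, hy⟩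
    rw [nhdsWithin_Ioc_eq_nhdsGT one_pos] at hx
    have hτ' := tendsto_inv_atTop_of_le_self hτ
    rcases lt_trichotomy a 0 with ha | ha | ha
    · exact Or.inl (Or.inl ⟨ha, hy.eq_of_tendsto (lim_neg ha hx hτ')⟩)
    · exact Or.inl (Or.inr ⟨ha, closure_mono (range_comp_subset_range _ g) hy.mem_closure_range⟩)
    · exact Or.inr ⟨ha, hy.eq_of_tendsto (lim_pos ha hx hτ')⟩
  · rintro ((⟨ha, rfl⟩ | ⟨rfl, hy⟩) | ⟨ha, rfl⟩)
    · exact ⟨mem_univ _, mem_univ _, fun _ => a, id, fun _ _ => mem_univ _,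
        fun ε hε => ⟨hε, le_rfl⟩, tendsto_const_nhds,
        isClusterPtNet_of_tendsto (lim_neg ha tendsto_const_nhds tendsto_inv_nhdsGT_zero)⟩
    · exact zero_mem_genGraph_of_mem_closure hy
    · exact ⟨mem_univ _, mem_univ _, fun _ => a, id, fun _ _ => mem_univ _,
        fun ε hε => ⟨hε, le_rfl⟩, tendsto_const_nhds,
        isClusterPtNet_of_tendsto (lim_pos ha tendsto_const_nhds tendsto_inv_nhdsGT_zero)⟩
end
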